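/- Restriction of the CDT to measures supported in a Borel set: let Ω₀, Ω ⊆ EReal be Borel sets and μ₀ a Borel probability measure on EReal with μ₀(Ω₀ᶜ) = 0 that gives no mass to atoms. Then: (i) for every probability measure ν on EReal with ν(Ωᶜ) = 0, its transform ν̂ = F_ν† ∘ F_{μ₀} satisfies ν̂(x) ∈ Ω for μ₀-a.e. x; (ii) conversely, if φ : EReal → EReal is measurable, non-decreasing μ₀-a.e., and φ(x) ∈ Ω for μ₀-a.e. x, then the probability measure φ_# μ₀ satisfies (φ_# μ₀)(Ωᶜ) = 0. Hence the transform restricts to a bijection between probability measures concentrated on Ω and (μ₀-a.e. classes of) non-decreasing functions taking values in Ω μ₀-a.e. -/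

import Mathlib

open MeasureTheory Set
open scoped ENNReal

noncomputable def dagger (F : EReal → EReal) : EReal → EReal :=
  fun y => sInf {x : EReal | F x > y}

/-- The CDF of a measure on `EReal`, viewed as a map `EReal → EReal`. -/
noncomputable def cdf (η : Measure EReal) : EReal → EReal :=
  fun x => ((η (Set.Iic x)).toReal : EReal)

/-- The cumulative distribution transform of `ν` with respect to the reference `μ₀`. -/
noncomputable def cdt (μ₀ ν : Measure EReal) : EReal → EReal :=
  dagger (cdf ν) ∘ cdf μ₀

lemma cdf_mono (η : Measure EReal) [IsProbabilityMeasure η] : Monotone (cdf η) := by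
  intro x y h
  unfold cdf
  exact EReal.coe_le_coe_iff.2
    (ENNReal.toReal_mono (measure_ne_top _ _) (measure_mono (Iic_subset_Iic.2 h)))

lemma cdf_lt_iff (μ η : Measure EReal) [IsProbabilityMeasure μ] [IsProbabilityMeasure η]
    (x y : EReal) : cdf μ x < cdf η y ↔ μ (Iic x) < η (Iic y) := by
  unfold cdf
  rw [EReal.coe_lt_coe_iff, ENNReal.toReal_lt_toReal (measure_ne_top _ _) (measure_ne_top _ _)]

lemma tendsto_meas_Iic (η : Measure EReal) [IsProbabilityMeasure η] (a : EReal)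
    (l : Filter EReal) [l.IsCountablyGenerated]
    (h : ∀ᵐ y ∂η, ∀ᶠ x in l, (y ≤ x ↔ y ≤ a)) :
    Filter.Tendsto (fun x => η (Iic x)) l (nhds (η (Iic a))) := by
  have e : ∀ x, η (Iic x) = ∫⁻ y, (Iic x).indicator 1 y ∂η := by
    intro x; rw [lintegral_indicator_one measurableSet_Iic]
  simp_rw [e]
  refine tendsto_lintegral_filter_of_dominated_convergence (fun _ => 1) ?_ ?_ ?_ ?_
  · exact Filter.Eventually.of_forall fun x => measurable_one.indicator measurableSet_Iic
  · refine Filter.Eventually.of_forall fun x => Filter.Eventually.of_forall fun y => ?_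
    exact indicator_le_self' (fun _ _ => zero_le) y
  · simp
  · filter_upwards [h] with y hy
    refine tendsto_const_nhds.congr' ?_
    filter_upwards [hy] with x hx
    simp only [indicator, mem_Iic, hx]

lemma right_cont (η : Measure EReal) [IsProbabilityMeasure η] (a : EReal) :
    Filter.Tendsto (fun x => η (Iic x)) (nhdsWithin a (Ioi a)) (nhds (η (Iic a))) := by
  refine tendsto_meas_Iic η a _ (Filter.Eventually.of_forall fun y => ?_)
  rcases le_or_gt y a with h | h
  · filter_upwards [self_mem_nhdsWithin] with x hx
    exact ⟨fun _ => h, fun _ => h.trans (le_of_lt hx)⟩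
  · filter_upwards [mem_nhdsWithin_of_mem_nhds (Iio_mem_nhds h)] with x hx
    exact ⟨fun h' => absurd hx (not_lt.2 h'), fun h' => absurd h (not_lt.2 h')⟩

lemma cont_Iic (μ : Measure EReal) [IsProbabilityMeasure μ] (hatoms : ∀ x : EReal, μ {x} = 0) :
    Continuous (fun x => μ (Iic x)) := by
  refine continuous_iff_continuousAt.2 fun a => tendsto_meas_Iic μ a _ ?_
  have : ∀ᵐ y ∂μ, y ≠ a := by
    rw [ae_iff]; simpa using hatoms a
  filter_upwards [this] with y hy
  rcases lt_or_gt_of_ne hy with h | h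
  · filter_upwards [Ioi_mem_nhds h] with x hx
    exact ⟨fun _ => h.le, fun _ => le_of_lt hx⟩
  · filter_upwards [Iio_mem_nhds h] with x hx
    exact ⟨fun h' => absurd hx (not_lt.2 h'), fun h' => absurd h (not_lt.2 h')⟩

lemma unif_le (μ : Measure EReal) [IsProbabilityMeasure μ] (hatoms : ∀ x : EReal, μ {x} = 0)
    (t : ℝ≥0∞) : μ {x | μ (Iic x) ≤ t} ≤ t := by
  have hc : IsClosed {x | μ (Iic x) ≤ t} := isClosed_le (cont_Iic μ hatoms) continuous_const
  have hne : {x | μ (Iic x) ≤ t}.Nonempty := by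
    refine ⟨⊥, ?_⟩
    simp [hatoms]
  have hb := hc.sSup_mem hne
  exact (measure_mono fun x hx => mem_Iic.2 (le_sSup hx)).trans hb

lemma le_unif (μ : Measure EReal) [IsProbabilityMeasure μ] (hatoms : ∀ x : EReal, μ {x} = 0)
    (t : ℝ≥0∞) (ht : t ≤ 1) : t ≤ μ {x | μ (Iic x) < t} := by
  have hc : IsClosed {x | t ≤ μ (Iic x)} := isClosed_le continuous_const (cont_Iic μ hatoms)
  have hne : {x | t ≤ μ (Iic x)}.Nonempty := by
    refine ⟨⊤, ?_⟩
    simpa using ht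
  have hb : t ≤ μ (Iic (sInf {x | t ≤ μ (Iic x)})) := hc.sInf_mem hne
  have : NullSingletonClass μ := ⟨hatoms⟩
  rw [← measure_congr (Iio_ae_eq_Iic (μ := μ))] at hb
  refine hb.trans (measure_mono fun x hx => ?_)
  by_contra h
  have h' : x ∈ {x | t ≤ μ (Iic x)} := by
    simpa only [mem_setOf_eq, not_lt] using h
  exact absurd (mem_Iio.1 hx) (not_lt.2 (sInf_le h'))

lemma cdt_mono (μ ν : Measure EReal) [IsProbabilityMeasure μ] : Monotone (cdt μ ν) := by
  intro x y h
  refine sInf_le_sInf fun z hz => ?_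
  exact lt_of_le_of_lt (cdf_mono μ h) hz

lemma map_cdt (μ ν : Measure EReal) [IsProbabilityMeasure μ] [IsProbabilityMeasure ν]
    (hatoms : ∀ x : EReal, μ {x} = 0) : Measure.map (cdt μ ν) μ = ν := by
  have hm := (cdt_mono μ ν).measurable
  have := Measure.isProbabilityMeasure_map (μ := μ) hm.aemeasurable
  refine Measure.ext_of_Iic _ _ fun a => ?_
  rw [Measure.map_apply hm measurableSet_Iic]
  apply le_antisymm
  · refine (measure_mono fun x hx => ?_).trans (unif_le μ hatoms (ν (Iic a)))
    rcases eq_or_ne a ⊤ with rfl | ha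
    · simpa using prob_le_one
    have hx' : cdt μ ν x ≤ a := hx
    have : (nhdsWithin a (Ioi a)).NeBot := nhdsGT_neBot_of_exists_gt ⟨⊤, lt_top_iff_ne_top.2 ha⟩
    refine ge_of_tendsto (right_cont ν a) ?_
    filter_upwards [self_mem_nhdsWithin] with z hz
    obtain ⟨w, hw, hwz⟩ := sInf_lt_iff.1 (lt_of_le_of_lt hx' hz)
    exact ((cdf_lt_iff μ ν x w).1 hw).le.trans (measure_mono (Iic_subset_Iic.2 hwz.le))
  · refine (le_unif μ hatoms (ν (Iic a)) prob_le_one).trans (measure_mono fun x hx => ?_)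
    have h : a ∈ {z : EReal | cdf ν z > cdf μ x} := (cdf_lt_iff μ ν x a).2 hx
    exact sInf_le h

lemma null_of_mono (μ : Measure EReal) [IsProbabilityMeasure μ] {f g : EReal → EReal}
    (hf : Monotone f) (hg : Monotone g) (h : Measure.map f μ = Measure.map g μ) :
    ∀ᵐ x ∂μ, g x ≤ f x := by
  have key : ∀ q : ℚ, ∀ᵐ x ∂μ, f x ≤ ((q : ℝ) : EReal) → g x ≤ ((q : ℝ) : EReal) := by
    intro q
    set c : EReal := ((q : ℝ) : EReal)
    have e : μ (f ⁻¹' Iic c) = μ (g ⁻¹' Iic c) := by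
      rw [← Measure.map_apply hf.measurable measurableSet_Iic, h,
        Measure.map_apply hg.measurable measurableSet_Iic]
    have l1 : IsLowerSet (f ⁻¹' Iic c) := fun a b hab ha => (hf hab).trans ha
    have l2 : IsLowerSet (g ⁻¹' Iic c) := fun a b hab ha => (hg hab).trans ha
    rcases l1.total l2 with hs | hs
    · exact Filter.Eventually.of_forall fun x hx => hs hx
    · have := ae_eq_of_subset_of_measure_ge hs e.le
        (hg.measurable measurableSet_Iic).nullMeasurableSet (measure_ne_top _ _)
      filter_upwards [this.mem_iff] with x hx h1
      exact hx.2 h1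
  filter_upwards [ae_all_iff.2 key] with x hx
  by_contra hlt
  obtain ⟨q, h1, h2⟩ := EReal.lt_iff_exists_rat_btwn.1 (not_le.1 hlt)
  exact absurd (hx q h1.le) (not_le.2 h2)

theorem cdt_restriction_bijection (Ω₀ Ω : Set EReal)
    (hΩ₀ : MeasurableSet Ω₀) (hΩ : MeasurableSet Ω)
    (μ₀ : Measure EReal) [IsProbabilityMeasure μ₀]
    (hsupp : μ₀ Ω₀ᶜ = 0) (hatoms : ∀ x : EReal, μ₀ {x} = 0) :
    -- (i) the transform of a measure concentrated on Ω takes values in Ω a.e.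
    (∀ (ν : Measure EReal), IsProbabilityMeasure ν → ν Ωᶜ = 0 →
      ∀ᵐ x ∂μ₀, cdt μ₀ ν x ∈ Ω) ∧
    -- (ii) a non-decreasing a.e. function with values a.e. in Ω pushes μ₀ into Ω
    (∀ φ : EReal → EReal, Measurable φ →
      (∃ ψ : EReal → EReal, Monotone ψ ∧ φ =ᵐ[μ₀] ψ) →
      (∀ᵐ x ∂μ₀, φ x ∈ Ω) →
      (Measure.map φ μ₀) Ωᶜ = 0) ∧
    -- hence: the restricted transform is injective ...
    (∀ (ν η : Measure EReal), IsProbabilityMeasure ν → IsProbabilityMeasure η →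
      ν Ωᶜ = 0 → η Ωᶜ = 0 → cdt μ₀ ν =ᵐ[μ₀] cdt μ₀ η → ν = η) ∧
    -- ... and surjective onto (a.e. classes of) non-decreasing functions valued in Ω
    (∀ φ : EReal → EReal, Measurable φ →
      (∃ ψ : EReal → EReal, Monotone ψ ∧ φ =ᵐ[μ₀] ψ) →
      (∀ᵐ x ∂μ₀, φ x ∈ Ω) →
      cdt μ₀ (Measure.map φ μ₀) =ᵐ[μ₀] φ) := by
  refine ⟨?_, ?_, ?_, ?_⟩
  · intro ν hν h
    rw [← map_cdt μ₀ ν hatoms] at h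
    rw [Measure.map_apply (cdt_mono μ₀ ν).measurable hΩ.compl] at h
    exact h
  · intro φ hφ _ h
    rw [Measure.map_apply hφ hΩ.compl]
    exact h
  · intro ν η hν hη _ _ h
    rw [← map_cdt μ₀ ν hatoms, ← map_cdt μ₀ η hatoms]
    exact Measure.map_congr h
  · rintro φ hφ ⟨ψ, hψ, hψe⟩ _
    have := Measure.isProbabilityMeasure_map (μ := μ₀) hφ.aemeasurable
    have e : Measure.map (cdt μ₀ (Measure.map φ μ₀)) μ₀ = Measure.map ψ μ₀ :=
      (map_cdt μ₀ _ hatoms).trans (Measure.map_congr hψe)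
    have hm := cdt_mono μ₀ (Measure.map φ μ₀)
    filter_upwards [null_of_mono μ₀ hm hψ e, null_of_mono μ₀ hψ hm e.symm, hψe] with x h1 h2 h3
    rw [h3]
    exact le_antisymm h2 h1
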